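/- arXiv:2309.10471 — 2 statements merged into one kernel-verified Lean document; each statement's English description precedes it below -/
import Mathlib

section
/- Let L be a Lie algebra over ℝ and let s ⊆ L. Then the Lie subalgebra of L generated by s coincides, as an ℝ-submodule of L, with the ℝ-linear span of the set of all iterated brackets [x_k, [x_{k-1}, …, [x_2, x_1]⋯]] with k ≥ 1 and x_1, …, x_k ∈ s. -/
/-- A submodule stable under bracketing with the elements of `s` is stable under bracketing with
the Lie subalgebra generated by `s`. -/
theorem LieSubalgebra.lie_mem_of_mem_lieSpan {R L M : Type*} [CommRing R] [LieRing L]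
    [LieAlgebra R L] [AddCommGroup M] [Module R M] [LieRingModule L M] [LieModule R L M]
    {s : Set L} {N : Submodule R M} (h : ∀ y ∈ s, ∀ m ∈ N, ⁅y, m⁆ ∈ N) {x : L}
    (hx : x ∈ LieSubalgebra.lieSpan R L s) {m : M} (hm : m ∈ N) : ⁅x, m⁆ ∈ N := by
  induction hx using LieSubalgebra.lieSpan_induction generalizing m with
  | mem y hy => exact h y hy m hm
  | zero => simp
  | add x y _ _ hx hy => rw [add_lie]; exact N.add_mem (hx hm) (hy hm)
  | smul a x _ hx => rw [smul_lie]; exact N.smul_mem a (hx hm)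
  | lie x y _ _ hx hy => rw [lie_lie]; exact N.sub_mem (hx (hy hm)) (hy (hx hm))

/-- A Lie subalgebra is closed under iterated brackets. -/
theorem LieSubalgebra.foldl_lie_mem {R L : Type*} [CommRing R] [LieRing L] [LieAlgebra R L]
    (K : LieSubalgebra R L) {x : L} (hx : x ∈ K) {l : List L} (hl : ∀ y ∈ l, y ∈ K) :
    l.foldl (fun a y ↦ ⁅y, a⁆) x ∈ K := by
  induction l generalizing x with
  | nil => exact hx
  | cons y l ih =>
    rw [List.forall_mem_cons] at hl
    exact ih (K.lie_mem hl.1 hx) hl.2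

/-- **Statement 8.** The Lie subalgebra of a real Lie algebra generated by a subset `s` coincides,
as a submodule, with the linear span of all iterated brackets
`⁅xₖ, ⁅xₖ₋₁, …, ⁅x₂, x₁⁆⋯⁆⁆` (`k ≥ 1`) of elements of `s`. -/
theorem statement_8 {L : Type*} [LieRing L] [LieAlgebra ℝ L] (s : Set L) :
    (LieSubalgebra.lieSpan ℝ L s).toSubmodule =
      Submodule.span ℝ
        {z : L | ∃ (x : L) (l : List L), x ∈ s ∧ (∀ y ∈ l, y ∈ s) ∧
          z = l.foldl (fun a y ↦ ⁅y, a⁆) x} := by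
  apply le_antisymm
  · intro x hx
    rw [LieSubalgebra.mem_toSubmodule] at hx
    induction hx using LieSubalgebra.lieSpan_induction with
    | mem x hx => exact Submodule.subset_span ⟨x, [], hx, by simp, rfl⟩
    | zero => exact Submodule.zero_mem _
    | add _ _ _ _ hx hy => exact Submodule.add_mem _ hx hy
    | smul a _ _ hx => exact Submodule.smul_mem _ a hx
    | lie x y hx _ _ hy =>
      refine LieSubalgebra.lie_mem_of_mem_lieSpan (fun y hy m hm ↦ ?_) hx hy
      induction hm using Submodule.span_induction with
      | mem m hm =>
        obtain ⟨x, l, hx, hl, rfl⟩ := hm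
        refine Submodule.subset_span ⟨x, l ++ [y], hx, ?_, by simp⟩
        simpa [or_imp, forall_and] using ⟨hl, hy⟩
      | zero => simp
      | add _ _ _ _ hm hn => rw [lie_add]; exact Submodule.add_mem _ hm hn
      | smul a _ _ hm => rw [lie_smul]; exact Submodule.smul_mem _ a hm
  · rw [Submodule.span_le]
    rintro _ ⟨x, l, hx, hl, rfl⟩
    exact LieSubalgebra.foldl_lie_mem _ (LieSubalgebra.subset_lieSpan hx)
      fun y hy ↦ LieSubalgebra.subset_lieSpan (hl y hy)
end

section
/- Fix x ∈ ℝ^n. The ring of germs at x of real analytic real-valued functions is Noetherian: every ascending chain of ideals stabilizes. Moreover, for every m ∈ ℕ, the module of germs at x of real analytic ℝ^m-valued functions is a Noetherian module over this ring: every ascending chain of submodules stabilizes. -/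
open Filter Topology

noncomputable section

variable {n : ℕ} (x : EuclideanSpace ℝ (Fin n))

/-- The ring of germs at `x` of real analytic real-valued functions, as a subring of the ring of
germs at `x` of all functions, with pointwise operations. -/
def analyticGermRing : Subring (Germ (𝓝 x) ℝ) where
  carrier := {g | ∃ f : EuclideanSpace ℝ (Fin n) → ℝ,
    g = (f : Germ (𝓝 x) ℝ) ∧ ∀ᶠ y in 𝓝 x, AnalyticAt ℝ f y}
  add_mem' := by
    rintro a b ⟨f, rfl, hf⟩ ⟨g, rfl, hg⟩
    exact ⟨f + g, (Filter.Germ.coe_add _ _).symm,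
      (hf.and hg).mono fun y hy ↦ hy.1.add hy.2⟩
  mul_mem' := by
    rintro a b ⟨f, rfl, hf⟩ ⟨g, rfl, hg⟩
    exact ⟨f * g, (Filter.Germ.coe_mul _ _).symm,
      (hf.and hg).mono fun y hy ↦ hy.1.mul hy.2⟩
  one_mem' := ⟨1, rfl, Eventually.of_forall fun y ↦ analyticAt_const⟩
  zero_mem' := ⟨0, rfl, Eventually.of_forall fun y ↦ analyticAt_const⟩
  neg_mem' := by
    rintro a ⟨f, rfl, hf⟩
    exact ⟨-f, (Filter.Germ.coe_neg _).symm, hf.mono fun y hy ↦ hy.neg⟩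

variable (m : ℕ)

/-- The module of germs at `x` of real analytic `ℝ^m`-valued functions, as a submodule, over the
ring of germs at `x` of real analytic real-valued functions, of the module of germs of all
`ℝ^m`-valued functions, with pointwise operations. -/
def analyticGermModule :
    Submodule (analyticGermRing x) (Germ (𝓝 x) (EuclideanSpace ℝ (Fin m))) where
  carrier := {g | ∃ ξ : EuclideanSpace ℝ (Fin n) → EuclideanSpace ℝ (Fin m),
    g = (ξ : Germ (𝓝 x) (EuclideanSpace ℝ (Fin m))) ∧ ∀ᶠ y in 𝓝 x, AnalyticAt ℝ ξ y}
  add_mem' := by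
    rintro a b ⟨f, rfl, hf⟩ ⟨g, rfl, hg⟩
    exact ⟨f + g, (Filter.Germ.coe_add _ _).symm,
      (hf.and hg).mono fun y hy ↦ hy.1.add hy.2⟩
  zero_mem' := ⟨0, rfl, Eventually.of_forall fun y ↦ analyticAt_const⟩
  smul_mem' := by
    rintro ⟨c, f, rfl, hf⟩ a ⟨g, rfl, hg⟩
    exact ⟨f • g, (Filter.Germ.coe_smul' _ _).symm,
      (hf.and hg).mono fun y hy ↦ hy.1.smul hy.2⟩

/-- The Banach space of absolutely summable real families indexed by `σ`. -/
abbrev L1 (σ : Type*) := lp (fun _ : σ ↦ ℝ) 1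

namespace L1

variable {σ F : Type*} [NormedAddCommGroup F] [NormedSpace ℝ F]

open Classical in
/-- The standard unit vector of `L1 σ` at `α`. -/
def basis (α : σ) : L1 σ := lp.single 1 α 1

open Classical in
theorem basis_apply (α β : σ) : basis α β = if β = α then 1 else 0 := by
  simp [basis, Pi.single_apply]

theorem basis_apply_self (α : σ) : basis α α = 1 := by simp [basis_apply]

theorem norm_basis (α : σ) : ‖basis α‖ = 1 := by
  simp [basis]

theorem hasSum_norm (a : L1 σ) : HasSum (fun α ↦ ‖a α‖) ‖a‖ := by
  simpa using lp.hasSum_norm (p := 1) (by simp) a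

theorem clm_ext {A B : L1 σ →L[ℝ] F} (h : ∀ α, A (basis α) = B (basis α)) : A = B := by
  classical
  refine lp.ext_continuousLinearMap (by simp) fun α ↦ ?_
  ext
  simpa [basis, lp.single] using h α

variable [CompleteSpace F]

theorem summable_smul (v : σ → F) {C : ℝ} (hv : ∀ α, ‖v α‖ ≤ C) (a : L1 σ) :
    Summable fun α ↦ a α • v α := by
  refine .of_norm_bounded ((hasSum_norm a).summable.mul_right C) fun α ↦ ?_
  rw [norm_smul]
  gcongr
  exact hv α

/-- The continuous linear map on `L1 σ` sending the unit vectors to a given bounded family. -/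
def lift (v : σ → F) (C : ℝ) (hv : ∀ α, ‖v α‖ ≤ C) : L1 σ →L[ℝ] F :=
  LinearMap.mkContinuous
    { toFun := fun a ↦ ∑' α, a α • v α
      map_add' := fun a b ↦ by
        simp only [lp.coeFn_add, Pi.add_apply, add_smul]
        exact (summable_smul v hv a).tsum_add (summable_smul v hv b)
      map_smul' := fun c a ↦ by
        simp only [lp.coeFn_smul, Pi.smul_apply, smul_assoc, RingHom.id_apply]
        exact (summable_smul v hv a).tsum_const_smul c } C fun a ↦ by
    refine tsum_of_norm_bounded ((hasSum_norm a).mul_left C) fun α ↦ ?_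
    rw [norm_smul, mul_comm]
    gcongr
    exact hv α

@[simp]
theorem lift_basis (v : σ → F) (C : ℝ) (hv : ∀ α, ‖v α‖ ≤ C) (α : σ) :
    lift v C hv (basis α) = v α := by
  change ∑' β, basis α β • v β = v α
  rw [tsum_eq_single α fun β hβ ↦ by simp [basis_apply, hβ]]
  simp [basis_apply]

theorem norm_apply_le_of_basis (A : L1 σ →L[ℝ] F) {C : ℝ} (h : ∀ α, ‖A (basis α)‖ ≤ C)
    (a : L1 σ) : ‖A a‖ ≤ C * ‖a‖ := by
  rw [show A = lift _ C h from clm_ext fun α ↦ by simp]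
  refine tsum_of_norm_bounded ((hasSum_norm a).mul_left C) fun α ↦ ?_
  rw [norm_smul, mul_comm]
  gcongr
  exact h α

/-- Coordinatewise multiplication by a bounded family. -/
def diag (d : σ → ℝ) (C : ℝ) (hd : ∀ α, |d α| ≤ C) : L1 σ →L[ℝ] L1 σ :=
  lift (fun α ↦ d α • basis α) C fun α ↦ by simpa [norm_smul, norm_basis] using hd α

theorem diag_apply (d : σ → ℝ) (C : ℝ) (hd : ∀ α, |d α| ≤ C) (a : L1 σ) (α : σ) :
    diag d C hd a α = d α * a α := by
  have : (lp.evalCLM ℝ (fun _ : σ ↦ ℝ) 1 α).comp (diag d C hd) =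
      d α • lp.evalCLM ℝ (fun _ : σ ↦ ℝ) 1 α := by
    refine clm_ext fun β ↦ ?_
    change diag d C hd (basis β) α = d α * basis β α
    by_cases h : α = β <;> simp [diag, basis_apply, h]
  exact DFunLike.congr_fun this a

theorem norm_diag_apply_le (d : σ → ℝ) (C : ℝ) (hd : ∀ α, |d α| ≤ C) (a : L1 σ) :
    ‖diag d C hd a‖ ≤ C * ‖a‖ :=
  norm_apply_le_of_basis _ (fun α ↦ by simpa [diag, norm_smul, norm_basis] using hd α) a

end L1

/-- The monomial with exponent `α` evaluated at `u`. -/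
def monomialEval {n : ℕ} (u : Fin n → ℝ) (α : Fin n → ℕ) : ℝ := ∏ i, u i ^ α i

theorem monomialEval_add {n : ℕ} (u : Fin n → ℝ) (α β : Fin n → ℕ) :
    monomialEval u (α + β) = monomialEval u α * monomialEval u β := by
  simp [monomialEval, pow_add, Finset.prod_mul_distrib]

theorem abs_monomialEval_le_one {n : ℕ} {u : Fin n → ℝ} (hu : ∀ i, |u i| ≤ 1) (α : Fin n → ℕ) :
    |monomialEval u α| ≤ 1 := by
  rw [monomialEval, Finset.abs_prod]
  exact Finset.prod_le_one (fun _ _ ↦ abs_nonneg _) fun i _ ↦ by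
    rw [abs_pow]; exact pow_le_one₀ (abs_nonneg _) (hu i)

namespace L1

variable {n : ℕ}

open Classical in
/-- The value at `u` of the power series with coefficients `a`, for `u` in the closed unit
polydisc (and zero for other `u`). -/
def eval (u : Fin n → ℝ) : L1 (Fin n → ℕ) →L[ℝ] ℝ :=
  lift (fun α ↦ if ∀ i, |u i| ≤ 1 then monomialEval u α else 0) 1 fun α ↦ by
    split_ifs with hu
    · exact abs_monomialEval_le_one hu α
    · simp

theorem eval_basis {u : Fin n → ℝ} (hu : ∀ i, |u i| ≤ 1) (α : Fin n → ℕ) :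
    eval u (basis α) = monomialEval u α := by
  simp [eval, hu]

/-- Multiplication of power series by the monomial with exponent `α`. -/
def shift (α : Fin n → ℕ) : L1 (Fin n → ℕ) →L[ℝ] L1 (Fin n → ℕ) :=
  lift (fun β ↦ basis (α + β)) 1 fun _ ↦ (norm_basis _).le

theorem norm_shift_apply_le (α : Fin n → ℕ) (a : L1 (Fin n → ℕ)) : ‖shift α a‖ ≤ ‖a‖ := by
  simpa using norm_apply_le_of_basis (shift α) (C := 1)
    (fun β ↦ by simp [shift, norm_basis]) a

theorem eval_shift {u : Fin n → ℝ} (hu : ∀ i, |u i| ≤ 1) (α : Fin n → ℕ) (a : L1 (Fin n → ℕ)) :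
    eval u (shift α a) = monomialEval u α * eval u a := by
  have : (eval u).comp (shift α) = monomialEval u α • eval u :=
    clm_ext fun β ↦ by simp [shift, eval_basis hu, monomialEval_add]
  exact DFunLike.congr_fun this a

/-- Multiplication of power series by `f`. -/
def mul (f : L1 (Fin n → ℕ)) : L1 (Fin n → ℕ) →L[ℝ] L1 (Fin n → ℕ) :=
  lift (fun α ↦ shift α f) ‖f‖ fun α ↦ norm_shift_apply_le α f

theorem eval_mul {u : Fin n → ℝ} (hu : ∀ i, |u i| ≤ 1) (f a : L1 (Fin n → ℕ)) :
    eval u (mul f a) = eval u f * eval u a := by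
  have : (eval u).comp (mul f) = eval u f • eval u :=
    clm_ext fun β ↦ by simp [mul, eval_basis hu, eval_shift hu, mul_comm]
  exact DFunLike.congr_fun this a

/-- Division with remainder of a power series by finitely many power series `f t`, each close to
the monomial with exponent `t`. -/
theorem exists_eq_sum_mul_add (T : Finset (Fin n → ℕ)) (M : Set (Fin n → ℕ))
    (hM : ∀ α ∈ M, ∃ t ∈ T, t ≤ α) (f : (Fin n → ℕ) → L1 (Fin n → ℕ))
    (hf : ∀ t ∈ T, ‖f t - basis t‖ ≤ 1 / 2) (g : L1 (Fin n → ℕ)) :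
    ∃ (Q : (Fin n → ℕ) → L1 (Fin n → ℕ)) (R : L1 (Fin n → ℕ)),
      g = ∑ t ∈ T, mul (f t) (Q t) + R ∧ ∀ α ∈ M, R α = 0 := by
  classical
  choose! τ hτT hτ using hM
  let q (t : Fin n → ℕ) : L1 (Fin n → ℕ) →L[ℝ] L1 (Fin n → ℕ) :=
    lift (fun α ↦ if α ∈ M ∧ τ α = t then basis (α - t) else 0) 1 fun α ↦ by
      split_ifs <;> simp [norm_basis]
  let r : L1 (Fin n → ℕ) →L[ℝ] L1 (Fin n → ℕ) :=
    diag (fun α ↦ if α ∈ M then 0 else 1) 1 fun α ↦ by split_ifs <;> simp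
  let Φ : L1 (Fin n → ℕ) →L[ℝ] L1 (Fin n → ℕ) := ∑ t ∈ T, (mul (f t)).comp (q t) + r
  have hΦ : ‖1 - Φ‖ < 1 := by
    refine lt_of_le_of_lt (ContinuousLinearMap.opNorm_le_bound _ (M := 1 / 2) (by norm_num)
      (norm_apply_le_of_basis _ fun α ↦ ?_)) (by norm_num)
    by_cases hα : α ∈ M
    · have h1 : Φ (basis α) = shift (α - τ α) (f (τ α)) := by
        simp only [Φ, add_apply, sum_apply,
          ContinuousLinearMap.comp_apply, q, r, diag, lift_basis, hα, if_true, true_and,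
          zero_smul, add_zero]
        rw [Finset.sum_eq_single_of_mem (τ α) (hτT α hα) fun t _ ht ↦ by simp [ht.symm]]
        simp [mul]
      have h2 : (basis α : L1 (Fin n → ℕ)) = shift (α - τ α) (basis (τ α)) := by
        simp [shift, tsub_add_cancel_of_le (hτ α hα)]
      rw [sub_apply, one_apply_eq_self, h1, norm_sub_rev]
      rw [h2, ← map_sub]
      exact (norm_shift_apply_le _ _).trans (hf _ (hτT α hα))
    · simp [Φ, q, r, diag, hα]
  have hu := isUnit_one_sub_of_norm_lt_one hΦ
  rw [sub_sub_cancel] at hu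
  obtain ⟨Ψ, hΨ⟩ := hu.exists_right_inv
  refine ⟨fun t ↦ q t (Ψ g), r (Ψ g), ?_, fun α hα ↦ by simp [r, diag_apply, hα]⟩
  simpa [Φ] using DFunLike.congr_fun hΨ.symm g

/-- The linear map lowering the `i`-th exponent of each monomial by one, and killing the monomials
whose `i`-th exponent is zero. -/
def lower (i : Fin n) : L1 (Fin n → ℕ) →L[ℝ] L1 (Fin n → ℕ) :=
  lift (fun α ↦ if α i = 0 then 0 else basis (Function.update α i (α i - 1))) 1 fun α ↦ by
    split_ifs <;> simp [norm_basis]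

theorem eval_comp_one_sub_lower {u : Fin n → ℝ} (hu : ∀ i, |u i| ≤ 1) (i : Fin n) :
    (eval u).comp (1 - u i • lower i) = eval (Function.update u i 0) := by
  have hu' : ∀ j, |Function.update u i 0 j| ≤ 1 := fun j ↦ by
    by_cases h : j = i
    · subst h; simp
    · simpa [h] using hu j
  refine clm_ext fun α ↦ ?_
  have key (v : Fin n → ℝ) (β : Fin n → ℕ) :
      monomialEval v β = v i ^ β i * ∏ j ∈ Finset.univ.erase i, v j ^ β j :=
    (Finset.mul_prod_erase _ _ (Finset.mem_univ i)).symm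
  have h1 : ∏ j ∈ Finset.univ.erase i, Function.update u i 0 j ^ α j =
      ∏ j ∈ Finset.univ.erase i, u j ^ α j :=
    Finset.prod_congr rfl fun j hj ↦ by simp [Finset.ne_of_mem_erase hj]
  rw [eval_basis hu', key, h1]
  by_cases h : α i = 0
  · simp [lower, h, eval_basis hu, key u]
  · have h2 : ∏ j ∈ Finset.univ.erase i, u j ^ Function.update α i (α i - 1) j =
        ∏ j ∈ Finset.univ.erase i, u j ^ α j :=
      Finset.prod_congr rfl fun j hj ↦ by simp [Finset.ne_of_mem_erase hj]
    simp only [ContinuousLinearMap.comp_apply, sub_apply,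
      one_apply_eq_self, smul_apply, lower, lift_basis, h,
      if_false, map_sub, map_smul, eval_basis hu, key u, h2, Function.update_self, smul_eq_mul]
    rw [zero_pow h, zero_mul, ← mul_assoc, mul_pow_sub_one h, sub_self]

theorem analyticAt_eval_piecewise (S : Finset (Fin n)) :
    AnalyticAt ℝ (fun u : Fin n → ℝ ↦ eval (S.piecewise u 0)) 0 := by
  induction S using Finset.induction_on with
  | empty => simpa using analyticAt_const
  | insert i S hi ih =>
    have hT : AnalyticAt ℝ (fun u : Fin n → ℝ ↦ 1 - u i • lower i) 0 :=
      analyticAt_const.sub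
        (((ContinuousLinearMap.proj (R := ℝ) (φ := fun _ : Fin n ↦ ℝ) i).analyticAt 0).smul
          analyticAt_const)
    have hinv : AnalyticAt ℝ (fun u : Fin n → ℝ ↦ Ring.inverse (1 - u i • lower i)) 0 :=
      AnalyticAt.fun_comp (g := Ring.inverse)
        (by simpa using analyticAt_inverse (𝕜 := ℝ) (1 : (L1 (Fin n → ℕ) →L[ℝ] L1 (Fin n → ℕ))ˣ))
        hT
    have hcomp := ((ContinuousLinearMap.compL ℝ (L1 (Fin n → ℕ))
      (L1 (Fin n → ℕ)) ℝ).analyticAt_bilinear (_, _)).comp₂ ih hinv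
    refine hcomp.congr ?_
    have hunit : ∀ᶠ u : Fin n → ℝ in 𝓝 0, IsUnit (1 - u i • lower (n := n) i) :=
      hT.continuousAt.eventually (p := IsUnit) (Units.isOpen.mem_nhds (by simp))
    filter_upwards [hunit, Metric.closedBall_mem_nhds (0 : Fin n → ℝ) one_pos] with u hu hu1
    have hu2 : ∀ j, |(insert i S).piecewise u 0 j| ≤ 1 := fun j ↦ by
      by_cases hj : j ∈ insert i S
      · rw [Finset.piecewise_eq_of_mem _ _ _ hj]
        exact (norm_le_pi_norm u j).trans (by simpa using hu1)
      · simp [Finset.piecewise_eq_of_notMem _ _ _ hj]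
    have h := eval_comp_one_sub_lower hu2 i
    have h3 : Function.update ((insert i S).piecewise u 0) i 0 = S.piecewise u 0 := by
      ext j
      by_cases hj : j = i
      · subst hj; simp [hi]
      · by_cases hjS : j ∈ S <;> simp [hj, hjS, Finset.piecewise]
    rw [h3, Finset.piecewise_eq_of_mem _ _ _ (Finset.mem_insert_self i S)] at h
    change (eval (S.piecewise u 0)).comp (Ring.inverse (1 - u i • lower i)) = _
    rw [← h, ContinuousLinearMap.comp_assoc]
    change (eval _).comp ((1 - u i • lower i) * Ring.inverse (1 - u i • lower i)) = _
    rw [Ring.mul_inverse_cancel _ hu]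
    rfl

theorem analyticAt_eval : AnalyticAt ℝ (eval (n := n)) 0 := by
  simpa using analyticAt_eval_piecewise (n := n) Finset.univ

end L1

/-- The positive integer `∏ pᵢ ^ αᵢ`, where `pᵢ` is the `i`-th prime number. -/
def primeWeight {n : ℕ} (α : Fin n → ℕ) : ℕ := ∏ i : Fin n, Nat.nth Nat.Prime i ^ α i

section PrimeWeight

variable {n : ℕ}

theorem primeWeight_pos (α : Fin n → ℕ) : 0 < primeWeight α :=
  Finset.prod_pos fun i _ ↦ pow_pos (Nat.prime_nth_prime i).pos _

theorem primeWeight_injective : Function.Injective (primeWeight (n := n)) := by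
  have key (α : Fin n → ℕ) (j : Fin n) :
      (primeWeight α).factorization (Nat.nth Nat.Prime j) = α j := by
    rw [primeWeight, Nat.factorization_prod fun (i : Fin n) _ ↦
      pow_ne_zero (α i) (Nat.prime_nth_prime i).ne_zero]
    simp only [(Nat.prime_nth_prime _).factorization_pow, Finsupp.finsetSum_apply]
    rw [Finset.sum_eq_single_of_mem j (Finset.mem_univ j) fun i _ hij ↦ ?_]
    · simp
    · refine Finsupp.single_eq_of_ne fun h ↦ hij ?_
      exact Fin.ext (Nat.nth_injective Nat.infinite_setOfPred_prime h.symm)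
  intro α β h
  ext j
  rw [← key α, h, key]

theorem primeWeight_cast (α : Fin n → ℕ) :
    (primeWeight α : ℝ) = monomialEval (fun i : Fin n ↦ (Nat.nth Nat.Prime i : ℝ)) α := by
  simp [primeWeight, monomialEval]

end PrimeWeight

theorem monomialEval_mul {n : ℕ} (u v : Fin n → ℝ) (α : Fin n → ℕ) :
    monomialEval (u * v) α = monomialEval u α * monomialEval v α := by
  simp [monomialEval, mul_pow, Finset.prod_mul_distrib]

theorem monomialEval_pow {n : ℕ} (u : Fin n → ℝ) (k : ℕ) (α : Fin n → ℕ) :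
    monomialEval (u ^ k) α = monomialEval u α ^ k := by
  simp [monomialEval, ← Finset.prod_pow, pow_right_comm]

namespace L1

variable {n : ℕ}

/-- Multiplication of the coefficients by the inverse `k`-th powers of the weights. -/
def rescale (k : ℕ) : L1 (Fin n → ℕ) →L[ℝ] L1 (Fin n → ℕ) :=
  diag (fun α ↦ ((primeWeight α : ℝ) ^ k)⁻¹) 1 fun α ↦ by
    rw [abs_of_nonneg (by positivity)]
    exact inv_le_one_of_one_le₀ (one_le_pow₀ (mod_cast primeWeight_pos α))

theorem eval_rescale {u : Fin n → ℝ} {k : ℕ}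
    (hu : ∀ i : Fin n, |(Nat.nth Nat.Prime i : ℝ) ^ k * u i| ≤ 1) (a : L1 (Fin n → ℕ)) :
    eval (fun i : Fin n ↦ (Nat.nth Nat.Prime i : ℝ) ^ k * u i) (rescale k a) = eval u a := by
  have hu' (i : Fin n) : |u i| ≤ 1 := by
    refine le_trans ?_ (hu i)
    rw [abs_mul, abs_of_nonneg (by positivity : (0 : ℝ) ≤ (Nat.nth Nat.Prime i : ℝ) ^ k)]
    exact le_mul_of_one_le_left (abs_nonneg _)
      (one_le_pow₀ (mod_cast (Nat.prime_nth_prime i).one_le))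
  have : (eval fun i : Fin n ↦ (Nat.nth Nat.Prime i : ℝ) ^ k * u i).comp (rescale k) = eval u := by
    refine clm_ext fun α ↦ ?_
    have h := monomialEval_mul ((fun i : Fin n ↦ (Nat.nth Nat.Prime i : ℝ)) ^ k) u α
    rw [monomialEval_pow, ← primeWeight_cast] at h
    have h0 : (primeWeight α : ℝ) ^ k ≠ 0 := pow_ne_zero _ (mod_cast (primeWeight_pos α).ne')
    simp only [ContinuousLinearMap.comp_apply, rescale, diag, lift_basis, map_smul,
      eval_basis hu, eval_basis hu', smul_eq_mul]
    rw [inv_mul_eq_iff_eq_mul₀ h0, ← h]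
    rfl
  exact DFunLike.congr_fun this a

/-- The exponent `α` has minimal weight in the support of `a`. -/
def IsLeading (a : L1 (Fin n → ℕ)) (α : Fin n → ℕ) : Prop :=
  a α ≠ 0 ∧ ∀ β, primeWeight β < primeWeight α → a β = 0

theorem exists_isLeading {a : L1 (Fin n → ℕ)} (ha : a ≠ 0) : ∃ α, IsLeading a α := by
  have h : {α | a α ≠ 0}.Nonempty := by
    by_contra! h
    refine ha (lp.ext (funext fun α ↦ ?_))
    by_contra h'
    exact (h ▸ h' : α ∈ (∅ : Set (Fin n → ℕ)))
  obtain ⟨α, hα, hmin⟩ := exists_minimalFor_of_wellFoundedLT (· ∈ {α | a α ≠ 0}) primeWeight h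
  refine ⟨α, hα, fun β hβ ↦ ?_⟩
  by_contra h'
  exact absurd (hmin h' hβ.le) (not_le.mpr hβ)

theorem IsLeading.eventually_norm_rescale_sub_le {a : L1 (Fin n → ℕ)} {α : Fin n → ℕ}
    (h : IsLeading a α) {ε : ℝ} (hε : 0 < ε) :
    ∀ᶠ k in atTop, ‖((primeWeight α : ℝ) ^ k / a α) • rescale k a - basis α‖ ≤ ε := by
  set θ : ℝ := primeWeight α / (primeWeight α + 1) with hθ
  have hα : (0 : ℝ) < primeWeight α := mod_cast primeWeight_pos α
  have hθ0 : 0 ≤ θ := by positivity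
  have hθ1 : θ < 1 := by rw [hθ, div_lt_one (by positivity)]; linarith
  have hlim : Tendsto (fun k : ℕ ↦ |a α|⁻¹ * (θ ^ k * ‖a‖)) atTop (𝓝 0) := by
    simpa using ((tendsto_pow_atTop_nhds_zero_of_lt_one hθ0 hθ1).mul_const ‖a‖).const_mul |a α|⁻¹
  filter_upwards [hlim.eventually (ge_mem_nhds hε)] with k hk
  refine le_trans ?_ hk
  let d (β : Fin n → ℕ) : ℝ :=
    if primeWeight α < primeWeight β then ((primeWeight α : ℝ) / primeWeight β) ^ k else 0
  have hd (β : Fin n → ℕ) : |d β| ≤ θ ^ k := by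
    by_cases hβ : primeWeight α < primeWeight β
    · have : (primeWeight α : ℝ) + 1 ≤ primeWeight β := mod_cast hβ
      simp only [d, hβ, if_true]
      rw [abs_of_nonneg (by positivity)]
      exact pow_le_pow_left₀ (by positivity) (by rw [hθ]; gcongr) k
    · simp only [d, hβ, if_false, abs_zero]
      positivity
  have heq : ((primeWeight α : ℝ) ^ k / a α) • rescale k a - basis α =
      (a α)⁻¹ • diag d (θ ^ k) hd a := by
    ext β
    have hβ0 : (primeWeight β : ℝ) ≠ 0 := mod_cast (primeWeight_pos β).ne'
    simp only [lp.coeFn_sub, lp.coeFn_smul, Pi.sub_apply, Pi.smul_apply, rescale, diag_apply,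
      smul_eq_mul]
    rcases lt_trichotomy (primeWeight α) (primeWeight β) with hβ | hβ | hβ
    · have : β ≠ α := by rintro rfl; exact hβ.false
      simp only [d, hβ, if_true, basis_apply, this, if_false, div_pow]
      field_simp
      simp
    · obtain rfl := primeWeight_injective hβ
      have := h.1
      simp only [d, lt_irrefl, if_false, basis_apply_self]
      field_simp
      simp
    · have : β ≠ α := by rintro rfl; exact hβ.false
      simp [d, hβ.not_gt, basis_apply, this, h.2 β hβ]
  rw [heq, norm_smul, norm_inv, Real.norm_eq_abs]
  gcongr
  exact norm_diag_apply_le _ _ _ _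

end L1

section Series

variable {n : ℕ} (x : EuclideanSpace ℝ (Fin n))

/-- The function given near `x` by the power series with coefficients `a` in the variables
`pᵢ ^ s * (yᵢ - xᵢ)`, where `pᵢ` is the `i`-th prime number. -/
def seriesFun (s : ℕ) (a : L1 (Fin n → ℕ)) (y : EuclideanSpace ℝ (Fin n)) : ℝ :=
  L1.eval (fun i : Fin n ↦ (Nat.nth Nat.Prime i : ℝ) ^ s * (y i - x i)) a

theorem analyticAt_scaled_sub (s : ℕ) :
    AnalyticAt ℝ (fun (y : EuclideanSpace ℝ (Fin n)) (i : Fin n) ↦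
      (Nat.nth Nat.Prime i : ℝ) ^ s * (y i - x i)) x :=
  AnalyticAt.pi fun i ↦ analyticAt_const.mul
    (((EuclideanSpace.proj (𝕜 := ℝ) i : EuclideanSpace ℝ (Fin n) →L[ℝ] ℝ).analyticAt x).sub
      analyticAt_const)

theorem eventually_scaled_sub_le (s : ℕ) :
    ∀ᶠ y in 𝓝 x, ∀ i : Fin n, |(Nat.nth Nat.Prime i : ℝ) ^ s * (y i - x i)| ≤ 1 := by
  have h : ∀ᶠ y in 𝓝 x, (fun i : Fin n ↦ (Nat.nth Nat.Prime i : ℝ) ^ s * (y i - x i)) ∈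
      Metric.closedBall (0 : Fin n → ℝ) 1 :=
    (analyticAt_scaled_sub x s).continuousAt.eventually_mem
      (by
        have h0 : (fun i : Fin n ↦ (Nat.nth Nat.Prime i : ℝ) ^ s * (x i - x i)) = 0 := by
          ext; simp
        rw [h0]
        exact Metric.closedBall_mem_nhds _ one_pos)
  filter_upwards [h] with y hy i
  exact (norm_le_pi_norm _ i).trans (mem_closedBall_zero_iff.mp hy)

theorem analyticAt_seriesFun (s : ℕ) (a : L1 (Fin n → ℕ)) : AnalyticAt ℝ (seriesFun x s a) x := by
  have h0 : (fun i : Fin n ↦ (Nat.nth Nat.Prime i : ℝ) ^ s * (x i - x i)) = 0 := by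
    ext; simp
  have h := AnalyticAt.fun_comp_of_eq L1.analyticAt_eval (analyticAt_scaled_sub x s) h0
  exact (((ContinuousLinearMap.apply ℝ ℝ a).analyticAt _).comp h)

theorem seriesFun_mul (s : ℕ) (f a : L1 (Fin n → ℕ)) :
    seriesFun x s (L1.mul f a) =ᶠ[𝓝 x] seriesFun x s f * seriesFun x s a := by
  filter_upwards [eventually_scaled_sub_le x s] with y hy
  exact L1.eval_mul hy f a

theorem seriesFun_add_rescale (s k : ℕ) (a : L1 (Fin n → ℕ)) :
    seriesFun x (s + k) (L1.rescale k a) =ᶠ[𝓝 x] seriesFun x s a := by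
  filter_upwards [eventually_scaled_sub_le x (s + k)] with y hy
  have h (i : Fin n) : (Nat.nth Nat.Prime i : ℝ) ^ (s + k) * (y i - x i) =
      (Nat.nth Nat.Prime i : ℝ) ^ k * ((Nat.nth Nat.Prime i : ℝ) ^ s * (y i - x i)) := by ring
  simp only [seriesFun, h] at hy ⊢
  exact L1.eval_rescale hy a

/-- The germ at `x` of the function `seriesFun x s a`. -/
def seriesGerm (s : ℕ) : L1 (Fin n → ℕ) →+ analyticGermRing x where
  toFun a := ⟨(seriesFun x s a : Germ (𝓝 x) ℝ), seriesFun x s a, rfl,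
    (analyticAt_seriesFun x s a).eventually_analyticAt⟩
  map_zero' := Subtype.ext (congrArg Germ.ofFun (funext fun y ↦ by simp [seriesFun]))
  map_add' a b := Subtype.ext (congrArg Germ.ofFun (funext fun y ↦ by simp [seriesFun]))

theorem seriesGerm_mul (s : ℕ) (f a : L1 (Fin n → ℕ)) :
    seriesGerm x s (L1.mul f a) = seriesGerm x s f * seriesGerm x s a :=
  Subtype.ext (Germ.coe_eq.mpr (seriesFun_mul x s f a))

theorem seriesGerm_add_rescale (s k : ℕ) (a : L1 (Fin n → ℕ)) :
    seriesGerm x (s + k) (L1.rescale k a) = seriesGerm x s a :=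
  Subtype.ext (Germ.coe_eq.mpr (seriesFun_add_rescale x s k a))

/-- The germ of a constant function. -/
def constGerm (c : ℝ) : analyticGermRing x :=
  ⟨((fun _ ↦ c : EuclideanSpace ℝ (Fin n) → ℝ) : Germ (𝓝 x) ℝ), _, rfl,
    Eventually.of_forall fun _ ↦ analyticAt_const⟩

theorem seriesGerm_smul (s : ℕ) (c : ℝ) (a : L1 (Fin n → ℕ)) :
    seriesGerm x s (c • a) = constGerm x c * seriesGerm x s a :=
  Subtype.ext (congrArg Germ.ofFun (funext fun y ↦ by simp [seriesFun]))

/-- The exponent of the monomial obtained by multiplying the variables along the word `j`. -/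
def wordExponent {k : ℕ} (j : Fin k → Fin n) (i : Fin n) : ℕ :=
  (Finset.univ.filter fun l ↦ j l = i).card

theorem monomialEval_wordExponent (u : Fin n → ℝ) {k : ℕ} (j : Fin k → Fin n) :
    monomialEval u (wordExponent j) = ∏ l, u (j l) := by
  rw [← Finset.prod_fiberwise_of_maps_to (g := j) (fun l _ ↦ Finset.mem_univ (j l))]
  refine Finset.prod_congr rfl fun i _ ↦ ?_
  rw [Finset.prod_congr rfl (g := fun _ ↦ u i) fun l hl ↦ by rw [(Finset.mem_filter.mp hl).2]]
  simp [wordExponent]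

theorem exists_eventuallyEq_seriesFun {f : EuclideanSpace ℝ (Fin n) → ℝ} (hf : AnalyticAt ℝ f x) :
    ∃ s a, f =ᶠ[𝓝 x] seriesFun x s a := by
  obtain ⟨p, hp⟩ := hf
  obtain ⟨C, r, hC, hr, hpC⟩ := p.le_mul_pow_of_radius_pos hp.radius_pos
  obtain ⟨s, hs⟩ := pow_unbounded_of_one_lt (n * r) (one_lt_two (α := ℝ))
  let e (i : Fin n) : EuclideanSpace ℝ (Fin n) := EuclideanSpace.single i 1
  let t (w : Σ k, Fin k → Fin n) : ℝ :=
    ((primeWeight (wordExponent w.2) : ℝ) ^ s)⁻¹ * p w.1 fun l ↦ e (w.2 l)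
  have ht (w : Σ k, Fin k → Fin n) : |t w| ≤ C * (r / 2 ^ s) ^ w.1 := by
    have h1 : (2 : ℝ) ^ w.1 ≤ primeWeight (wordExponent w.2) := by
      rw [primeWeight_cast, monomialEval_wordExponent]
      calc (2 : ℝ) ^ w.1 = ∏ _l : Fin w.1, (2 : ℝ) := by simp
        _ ≤ _ := Finset.prod_le_prod (fun _ _ ↦ by norm_num) fun l _ ↦
          mod_cast (Nat.prime_nth_prime _).two_le
    have h2 : ‖p w.1 fun l ↦ e (w.2 l)‖ ≤ C * r ^ w.1 :=
      ((p w.1).le_opNorm _).trans (by simpa [e] using hpC w.1)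
    rw [abs_mul, abs_of_nonneg (by positivity), div_pow, ← pow_mul, mul_comm s, pow_mul]
    calc _ ≤ (((2 : ℝ) ^ w.1) ^ s)⁻¹ * (C * r ^ w.1) := by gcongr; exact h2
      _ = _ := by ring
  have hsum : Summable fun w ↦ ‖t w • L1.basis (wordExponent w.2)‖ := by
    simp only [norm_smul, L1.norm_basis, mul_one, Real.norm_eq_abs]
    refine Summable.of_nonneg_of_le (fun _ ↦ abs_nonneg _) ht ?_
    rw [summable_sigma_of_nonneg fun _ ↦ by positivity]
    refine ⟨fun k ↦ Summable.of_finite, ?_⟩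
    have : Summable fun k : ℕ ↦ C * (n * r / 2 ^ s) ^ k :=
      (summable_geometric_of_lt_one (by positivity)
        (by rwa [div_lt_one (by positivity)])).mul_left C
    refine this.congr fun k ↦ ?_
    simp only [tsum_fintype, Finset.sum_const, Finset.card_univ, Fintype.card_fun, Fintype.card_fin,
      nsmul_eq_mul, Nat.cast_pow]
    ring
  refine ⟨s, ∑' w, t w • L1.basis (wordExponent w.2), ?_⟩
  filter_upwards [eventually_scaled_sub_le x s, hp.eventually_hasSum_sub] with y hy hpy
  have h1 := (L1.eval fun i : Fin n ↦ (Nat.nth Nat.Prime i : ℝ) ^ s * (y i - x i)).hasSum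
    hsum.of_norm.hasSum
  have h2 := h1.sigma fun k ↦ hasSum_fintype _
  refine hpy.unique (h2.congr_fun fun k ↦ ?_)
  have hy' : y - x = ∑ i, (y i - x i) • e i := by
    ext i
    simp [e, Finset.sum_apply, Pi.single_apply]
  rw [hy', (p k).map_sum]
  refine Finset.sum_congr rfl fun j _ ↦ ?_
  have h0 : (primeWeight (wordExponent j) : ℝ) ^ s ≠ 0 :=
    pow_ne_zero _ (mod_cast (primeWeight_pos _).ne')
  have h3 : monomialEval (fun i : Fin n ↦ (Nat.nth Nat.Prime i : ℝ) ^ s * (y i - x i))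
      (wordExponent j) =
      (primeWeight (wordExponent j) : ℝ) ^ s * ∏ l, (y (j l) - x (j l)) := by
    rw [primeWeight_cast, monomialEval_wordExponent, monomialEval_wordExponent,
      Finset.prod_mul_distrib, Finset.prod_pow]
  rw [(p k).map_smul_univ]
  simp only [map_smul, L1.eval_basis hy, h3, smul_eq_mul, t]
  field_simp

theorem exists_seriesGerm_eq (g : analyticGermRing x) : ∃ s a, seriesGerm x s a = g := by
  obtain ⟨_, f, rfl, hf⟩ := g
  obtain ⟨s, a, h⟩ := exists_eventuallyEq_seriesFun x hf.self_of_nhds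
  exact ⟨s, a, Subtype.ext (Germ.coe_eq.mpr h.symm)⟩

/-- Rückert's basis theorem for germs of real analytic functions. -/
theorem isNoetherianRing_analyticGermRing : IsNoetherianRing (analyticGermRing x) := by
  classical
  refine isNoetherianRing_iff_ideal_fg _ |>.mpr fun I ↦ ?_
  let M : Set (Fin n → ℕ) := {α | ∃ s a, seriesGerm x s a ∈ I ∧ L1.IsLeading a α}
  have hfin : {α | Minimal (· ∈ M) α}.Finite :=
    WellQuasiOrderedLE.finite_of_isAntichain (setOfPred_minimal_antichain _)
  let T := hfin.toFinset
  have hT : ∀ α ∈ M, ∃ t ∈ T, t ≤ α := fun α hα ↦ by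
    obtain ⟨t, ht, h⟩ := exists_minimal_le_of_wellFoundedLT (· ∈ M) α hα
    exact ⟨t, hfin.mem_toFinset.mpr h, ht⟩
  have hTM : ∀ t ∈ T, t ∈ M := fun t ht ↦ (hfin.mem_toFinset.mp ht).prop
  choose! s a hI hlead using hTM
  refine ⟨T.image fun t ↦ seriesGerm x (s t) (a t), le_antisymm (Ideal.span_le.mpr ?_) ?_⟩
  · simpa [Set.subset_def] using hI
  intro g hg
  obtain ⟨s₀, a₀, rfl⟩ := exists_seriesGerm_eq x g
  have hev : ∀ᶠ S in atTop, ∀ t ∈ T, ‖((primeWeight t : ℝ) ^ (S - s t) / a t t) •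
      L1.rescale (S - s t) (a t) - L1.basis t‖ ≤ 1 / 2 :=
    (Finset.eventually_all T).mpr fun t ht ↦
      (tendsto_sub_atTop_nat (s t)).eventually
        ((hlead t ht).eventually_norm_rescale_sub_le one_half_pos)
  obtain ⟨S, hS, hS₀, hST⟩ := (hev.and ((eventually_ge_atTop s₀).and
    ((Finset.eventually_all T).mpr fun t _ ↦ eventually_ge_atTop (s t)))).exists
  rw [← seriesGerm_add_rescale x s₀ (S - s₀), Nat.add_sub_cancel' hS₀] at hg ⊢
  set J := Ideal.span (↑(T.image fun t ↦ seriesGerm x (s t) (a t)) : Set (analyticGermRing x))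
  have hJI : J ≤ I := Ideal.span_le.mpr (by simpa [Set.subset_def] using hI)
  obtain ⟨Q, R, hQR, hR⟩ := L1.exists_eq_sum_mul_add T M hT _ hS (L1.rescale (S - s₀) a₀)
  have hsum : seriesGerm x S (L1.rescale (S - s₀) a₀) - seriesGerm x S R ∈ J := by
    rw [hQR, map_add, add_sub_cancel_right, map_sum]
    refine sum_mem fun t ht ↦ ?_
    rw [seriesGerm_mul, seriesGerm_smul]
    refine J.mul_mem_right _ (J.mul_mem_left _ ?_)
    have := seriesGerm_add_rescale x (s t) (S - s t) (a t)
    rw [Nat.add_sub_cancel' (hST t ht)] at this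
    rw [this]
    exact Ideal.subset_span (Finset.mem_coe.mpr (Finset.mem_image_of_mem _ ht))
  have hRI : seriesGerm x S R ∈ I := by
    simpa using I.sub_mem hg (hJI hsum)
  have hR0 : R = 0 := by
    by_contra h
    obtain ⟨α, hα⟩ := L1.exists_isLeading h
    exact hα.1 (hR α ⟨S, R, hRI, hα⟩)
  simpa [hR0] using hsum

theorem finite_analyticGermModule (d : ℕ) :
    Module.Finite (analyticGermRing x) (analyticGermModule x d) := by
  let e (i : Fin d) : analyticGermModule x d :=
    ⟨((fun _ ↦ EuclideanSpace.single i 1 :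
        EuclideanSpace ℝ (Fin n) → EuclideanSpace ℝ (Fin d)) :
        Germ (𝓝 x) (EuclideanSpace ℝ (Fin d))), _, rfl,
      Eventually.of_forall fun _ ↦ analyticAt_const⟩
  refine Module.Finite.of_surjective (Fintype.linearCombination (analyticGermRing x) e) ?_
  rintro ⟨_, ξ, rfl, hξ⟩
  refine ⟨fun i ↦ ⟨((fun y ↦ ξ y i : EuclideanSpace ℝ (Fin n) → ℝ) : Germ (𝓝 x) ℝ), _, rfl,
    hξ.mono fun y hy ↦
      ((EuclideanSpace.proj (𝕜 := ℝ) i : EuclideanSpace ℝ (Fin d) →L[ℝ] ℝ).analyticAt _).comp hy⟩,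
    Subtype.ext ?_⟩
  have hξ' : ξ = ∑ i, (fun y ↦ ξ y i) • fun _ ↦ EuclideanSpace.single i (1 : ℝ) := by
    ext y j
    simp [Finset.sum_apply, Pi.single_apply]
  have h := congrArg (Germ.coeAddHom (𝓝 x)) hξ'
  rw [map_sum] at h
  simp only [Fintype.linearCombination_apply, AddSubmonoidClass.coe_finsetSum]
  exact h.symm

end Series

/-- **Statement 9.** The ring of germs at a point `x ∈ ℝⁿ` of real analytic functions is
Noetherian (every ascending chain of ideals stabilizes), and for every `m` the module of germs at
`x` of real analytic `ℝ^m`-valued functions is a Noetherian module over it (every ascending chain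
of submodules stabilizes). -/
theorem statement_9 (n : ℕ) (x : EuclideanSpace ℝ (Fin n)) :
    (∀ I : ℕ → Ideal (analyticGermRing x),
      (∀ i, I i ≤ I (i + 1)) → ∃ N, ∀ j, N ≤ j → I j = I N) ∧
    (∀ m : ℕ, ∀ 𝒜 : ℕ → Submodule (analyticGermRing x) (analyticGermModule x m),
      (∀ i, 𝒜 i ≤ 𝒜 (i + 1)) → ∃ N, ∀ j, N ≤ j → 𝒜 j = 𝒜 N) := by
  have := isNoetherianRing_analyticGermRing x
  refine ⟨fun I hI ↦ ?_, fun m 𝒜 h𝒜 ↦ ?_⟩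
  · obtain ⟨N, hN⟩ := monotone_stabilizes_iff_noetherian.mpr this ⟨I, monotone_nat_of_le_succ hI⟩
    exact ⟨N, fun j hj ↦ (hN j hj).symm⟩
  · have := finite_analyticGermModule x m
    obtain ⟨N, hN⟩ := monotone_stabilizes_iff_noetherian.mpr
      (isNoetherian_of_isNoetherianRing_of_finite (analyticGermRing x) (analyticGermModule x m))
      ⟨𝒜, monotone_nat_of_le_succ h𝒜⟩
    exact ⟨N, fun j hj ↦ (hN j hj).symm⟩

end
end
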